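/- Let V : ℝ × E → E and p : ℝ × E → ℝ be smooth (ContDiff ℝ ⊤), and write V t := fun x => V (t, x). Assume: (i) there is a compact set K ⊆ E such that V (t, x) = 0 whenever x ∉ K; (ii) div (V t) (x) = 0 for all t and x; (iii) the Euler equation holds: for all t and x, deriv (fun s => V (s, x)) t = −fderiv ℝ (V t) x (V t x) − gradient (fun y => p (t, y)) x. Then the kinetic moment (helicity) m = ∫ ⟪curl V, V⟫ dx is a first integral: the function t ↦ ∫ ⟪curl (V t) (x), V (t, x)⟫ dx (integral over E with respect to the volume measure) is constant. -/

import Mathlib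

open MeasureTheory RealInnerProductSpace

noncomputable section

abbrev E : Type := EuclideanSpace ℝ (Fin 3)

/-- The `i`-th standard basis vector of `E`. -/
def e (i : Fin 3) : E := EuclideanSpace.single i 1

/-- The curl (vorticity) of a vector field on `E`. -/
def curl (X : E → E) (x : E) : E :=
  (WithLp.equiv 2 (Fin 3 → ℝ)).symm
    ![fderiv ℝ X x (e 1) 2 - fderiv ℝ X x (e 2) 1,
      fderiv ℝ X x (e 2) 0 - fderiv ℝ X x (e 0) 2,
      fderiv ℝ X x (e 0) 1 - fderiv ℝ X x (e 1) 0]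

/-- The divergence of a vector field on `E`. -/
def div (X : E → E) (x : E) : ℝ := ∑ i, fderiv ℝ X x (e i) i

/-- The cross product on `E`. -/
def cross (a b : E) : E :=
  (WithLp.equiv 2 (Fin 3 → ℝ)).symm
    ![a 1 * b 2 - a 2 * b 1,
      a 2 * b 0 - a 0 * b 2,
      a 0 * b 1 - a 1 * b 0]

infixl:74 " ×₃ " => cross

open Topology

/-- Directional derivative of a scalar function on space-time. -/
def DD (w : ℝ × E) (f : ℝ × E → ℝ) (q : ℝ × E) : ℝ := fderiv ℝ f q w

lemma DD_smooth {f : ℝ × E → ℝ} (hf : ContDiff ℝ (⊤ : ℕ∞) f) (w : ℝ × E) :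
    ContDiff ℝ (⊤ : ℕ∞) (DD w f) := by
  unfold DD
  exact (hf.fderiv_right (m := (⊤ : ℕ∞)) (by simp)).clm_apply contDiff_const

lemma smooth_diff {f : ℝ × E → ℝ} (hf : ContDiff ℝ (⊤ : ℕ∞) f) : Differentiable ℝ f :=
  hf.differentiable (by simp)

lemma DD_mul {f g : ℝ × E → ℝ} (hf : ContDiff ℝ (⊤ : ℕ∞) f) (hg : ContDiff ℝ (⊤ : ℕ∞) g)
    (w q : ℝ × E) : DD w (fun q => f q * g q) q = f q * DD w g q + g q * DD w f q := by
  unfold DD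
  rw [fderiv_fun_mul (smooth_diff hf q) (smooth_diff hg q)]
  simp

lemma DD_add {f g : ℝ × E → ℝ} (hf : ContDiff ℝ (⊤ : ℕ∞) f) (hg : ContDiff ℝ (⊤ : ℕ∞) g)
    (w q : ℝ × E) : DD w (fun q => f q + g q) q = DD w f q + DD w g q := by
  unfold DD
  rw [fderiv_fun_add (smooth_diff hf q) (smooth_diff hg q)]
  simp

lemma DD_sub {f g : ℝ × E → ℝ} (hf : ContDiff ℝ (⊤ : ℕ∞) f) (hg : ContDiff ℝ (⊤ : ℕ∞) g)
    (w q : ℝ × E) : DD w (fun q => f q - g q) q = DD w f q - DD w g q := by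
  unfold DD
  rw [fderiv_fun_sub (smooth_diff hf q) (smooth_diff hg q)]
  simp

lemma DD_comm {f : ℝ × E → ℝ} (hf : ContDiff ℝ (⊤ : ℕ∞) f) (u w q : ℝ × E) :
    DD u (DD w f) q = DD w (DD u f) q := by
  have h1 : ContDiff ℝ (⊤ : ℕ∞) (fderiv ℝ f) := hf.fderiv_right (m := (⊤ : ℕ∞)) (by simp)
  have h2 : Differentiable ℝ (fderiv ℝ f) := h1.differentiable (by simp)
  have key : ∀ a b : ℝ × E, DD a (DD b f) q = fderiv ℝ (fderiv ℝ f) q a b := by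
    intro a b
    change fderiv ℝ (fun q => fderiv ℝ f q b) q a = _
    rw [fderiv_clm_apply (h2 q) (differentiableAt_const b)]
    simp
  rw [key, key]
  exact (hf.contDiffAt.isSymmSndFDerivAt (by
    simp only [minSmoothness_of_isRCLikeNormedField]; exact WithTop.coe_le_coe.2 (le_top : (2 : ℕ∞) ≤ ⊤))) u w

/-- A derivative vanishes off the spatial support. -/
lemma DD_supp {f : ℝ × E → ℝ} {K : Set E} (hK : IsCompact K)
    (hf : ∀ q : ℝ × E, q.2 ∉ K → f q = 0) (w : ℝ × E) :
    ∀ q : ℝ × E, q.2 ∉ K → DD w f q = 0 := by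
  intro q hq
  have ho : IsOpen {q : ℝ × E | q.2 ∉ K} := hK.isClosed.isOpen_compl.preimage continuous_snd
  have : f =ᶠ[𝓝 q] fun _ => (0 : ℝ) := by
    filter_upwards [ho.mem_nhds hq] with a ha using hf a ha
  unfold DD
  rw [this.fderiv_eq]
  simp

lemma slice_integrable {f : ℝ × E → ℝ} (hf : Continuous f) {K : Set E} (hK : IsCompact K)
    (h0 : ∀ q : ℝ × E, q.2 ∉ K → f q = 0) (t : ℝ) :
    Integrable (fun x : E => f (t, x)) (volume : Measure E) := by
  apply Continuous.integrable_of_hasCompactSupport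
  · fun_prop
  · exact HasCompactSupport.intro hK fun x hx => h0 (t, x) hx

/-- The slice of a function on space-time. -/
lemma slice_fderiv {f : ℝ × E → ℝ} (hf : ContDiff ℝ (⊤ : ℕ∞) f) (t : ℝ) (x w : E) :
    fderiv ℝ (fun y => f (t, y)) x w = DD (0, w) f (t, x) := by
  have h := (smooth_diff hf (t, x)).hasFDerivAt.comp x (hasFDerivAt_prodMk_right t x)
  have h' : fderiv ℝ (fun y => f (t, y)) x = _ := h.fderiv
  rw [h']
  simp [DD]

lemma slice_time {f : ℝ × E → ℝ} (hf : ContDiff ℝ (⊤ : ℕ∞) f) (t : ℝ) (x : E) :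
    HasDerivAt (fun s => f (s, x)) (DD (1, 0) f (t, x)) t := by
  have h1 : HasDerivAt (fun s : ℝ => (s, x)) ((1 : ℝ), (0 : E)) t :=
    (hasDerivAt_id t).prodMk (hasDerivAt_const t x)
  exact (smooth_diff hf (t, x)).hasFDerivAt.comp_hasDerivAt t h1

lemma integral_DD_space {f : ℝ × E → ℝ} (hf : ContDiff ℝ (⊤ : ℕ∞) f) {K : Set E}
    (hK : IsCompact K) (h0 : ∀ q : ℝ × E, q.2 ∉ K → f q = 0) (t : ℝ) (w : E) :
    ∫ x, DD (0, w) f (t, x) ∂(volume : Measure E) = 0 := by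
  have hi := slice_integrable hf.continuous hK h0 t
  have hi' := slice_integrable (DD_smooth hf (0, w)).continuous hK (DD_supp hK h0 _) t
  have hd : Differentiable ℝ (fun y : E => f (t, y)) :=
    (smooth_diff hf).comp (by fun_prop)
  have := integral_mul_fderiv_eq_neg_fderiv_mul_of_integrable (μ := (volume : Measure E))
    (f := fun _ : E => (1 : ℝ)) (g := fun y => f (t, y)) (v := w)
    (by simp) (by simpa [slice_fderiv hf] using hi') (by simpa using hi)
    (by fun_prop) (by intro x _; exact hd x)
  simpa [slice_fderiv hf] using this

lemma integral_deriv {f : ℝ × E → ℝ} (hf : ContDiff ℝ (⊤ : ℕ∞) f) {K : Set E}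
    (hK : IsCompact K) (h0 : ∀ q : ℝ × E, q.2 ∉ K → f q = 0) (t : ℝ) :
    HasDerivAt (fun s => ∫ x, f (s, x) ∂(volume : Measure E))
      (∫ x, DD (1, 0) f (t, x) ∂(volume : Measure E)) t := by
  have hc := (DD_smooth hf (1, 0)).continuous
  obtain ⟨C, hC⟩ := ((isCompact_closedBall t 1).prod hK).exists_bound_of_continuousOn
    hc.continuousOn
  refine (hasDerivAt_integral_of_dominated_loc_of_deriv_le
    (F := fun s x => f (s, x)) (F' := fun s x => DD (1, 0) f (s, x))
    (s := Metric.closedBall t 1) (bound := K.indicator fun _ => C)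
    (Metric.closedBall_mem_nhds t one_pos) ?_ ?_ ?_ ?_ ?_ ?_).2
  · exact Filter.Eventually.of_forall fun s =>
      (slice_integrable hf.continuous hK h0 s).aestronglyMeasurable
  · exact slice_integrable hf.continuous hK h0 t
  · exact (slice_integrable hc hK (DD_supp hK h0 _) t).aestronglyMeasurable
  · refine Filter.Eventually.of_forall fun x s hs => ?_
    by_cases hx : x ∈ K
    · simpa [hx] using hC (s, x) ⟨hs, hx⟩
    · simp [hx, DD_supp hK h0 (1, 0) (s, x) hx]
  · exact (integrable_indicator_iff hK.measurableSet).2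
      (integrableOn_const hK.measure_lt_top.ne)
  · exact Filter.Eventually.of_forall fun x s _ => slice_time hf s x

/-- Purely scalar version: the derivative of the helicity density is a divergence. -/
lemma helicity_scalar (v : Fin 3 → ℝ × E → ℝ) (p : ℝ × E → ℝ)
    (hv : ∀ i, ContDiff ℝ (⊤ : ℕ∞) (v i)) (hp : ContDiff ℝ (⊤ : ℕ∞) p)
    (d : Fin 3 → E) (K : Set E) (hK : IsCompact K) (h0 : ∀ i, ∀ q : ℝ × E, q.2 ∉ K → v i q = 0)
    (heul : ∀ i q, DD (1, 0) (v i) q =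
      -(v 0 q * DD (0, d 0) (v i) q + v 1 q * DD (0, d 1) (v i) q
        + v 2 q * DD (0, d 2) (v i) q) - DD (0, d i) p q) (t₁ t₂ : ℝ) (h : ℝ × E → ℝ)
    (hh : h = fun q =>
      (DD (0, d 1) (v 2) q - DD (0, d 2) (v 1) q) * v 0 q
      + (DD (0, d 2) (v 0) q - DD (0, d 0) (v 2) q) * v 1 q
      + (DD (0, d 0) (v 1) q - DD (0, d 1) (v 0) q) * v 2 q) :
    ∫ x, h (t₁, x) ∂(volume : Measure E) = ∫ x, h (t₂, x) ∂(volume : Measure E) := by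
  have hD : ∀ w i, ContDiff ℝ (⊤ : ℕ∞) (DD w (v i)) := fun w i => DD_smooth (hv i) w
  have hsm : ContDiff ℝ (⊤ : ℕ∞) h := by
    rw [hh]
    exact ((((hD _ _).sub (hD _ _)).mul (hv _)).add (((hD _ _).sub (hD _ _)).mul (hv _))).add
      (((hD _ _).sub (hD _ _)).mul (hv _))
  have hh0 : ∀ q : ℝ × E, q.2 ∉ K → h q = 0 := by
    intro q hq
    simp [hh, h0 _ q hq]
  -- the flux
  let G : Fin 3 → Fin 3 → ℝ × E → ℝ := fun j k q =>
    (DD (1, 0) (v j) q * v k q - DD (1, 0) (v k) q * v j q)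
    - (v 0 q * v 0 q + v 1 q * v 1 q + v 2 q * v 2 q + (p q + p q))
      * (DD (0, d j) (v k) q - DD (0, d k) (v j) q)
  have hB : ContDiff ℝ (⊤ : ℕ∞) (fun q => v 0 q * v 0 q + v 1 q * v 1 q + v 2 q * v 2 q) :=
    (((hv 0).mul (hv 0)).add ((hv 1).mul (hv 1))).add ((hv 2).mul (hv 2))
  have hGs : ∀ j k, ContDiff ℝ (⊤ : ℕ∞) (G j k) := fun j k =>
    (((hD _ j).mul (hv k)).sub ((hD _ k).mul (hv j))).sub
      ((hB.add (hp.add hp)).mul ((hD _ k).sub (hD _ j)))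
  have hG0 : ∀ j k, ∀ q : ℝ × E, q.2 ∉ K → G j k q = 0 := by
    intro j k q hq
    simp [G, h0 _ q hq, DD_supp hK (h0 _) _ q hq]
  have hGd : ∀ j k w q, DD w (G j k) q =
      (DD (1, 0) (v j) q * DD w (v k) q + v k q * DD w (DD (1, 0) (v j)) q
        - (DD (1, 0) (v k) q * DD w (v j) q + v j q * DD w (DD (1, 0) (v k)) q))
      - ((v 0 q * v 0 q + v 1 q * v 1 q + v 2 q * v 2 q + (p q + p q))
          * (DD w (DD (0, d j) (v k)) q - DD w (DD (0, d k) (v j)) q)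
        + (DD (0, d j) (v k) q - DD (0, d k) (v j) q) *
          (v 0 q * DD w (v 0) q + v 0 q * DD w (v 0) q
           + (v 1 q * DD w (v 1) q + v 1 q * DD w (v 1) q)
           + (v 2 q * DD w (v 2) q + v 2 q * DD w (v 2) q) + (DD w p q + DD w p q))) := by
    intro j k w q
    simp only [G]
    rw [DD_sub (((hD _ j).mul (hv k)).sub ((hD _ k).mul (hv j)))
      ((hB.add (hp.add hp)).mul ((hD _ k).sub (hD _ j))),
      DD_sub ((hD _ j).mul (hv k)) ((hD _ k).mul (hv j)), DD_mul (hD _ j) (hv k),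
      DD_mul (hD _ k) (hv j), DD_mul (hB.add (hp.add hp)) ((hD _ k).sub (hD _ j)),
      DD_sub (hD _ k) (hD _ j), DD_add hB (hp.add hp), DD_add hp hp,
      DD_add (((hv 0).mul (hv 0)).add ((hv 1).mul (hv 1))) ((hv 2).mul (hv 2)),
      DD_add ((hv 0).mul (hv 0)) ((hv 1).mul (hv 1)), DD_mul (hv 0) (hv 0),
      DD_mul (hv 1) (hv 1), DD_mul (hv 2) (hv 2)]
  have key : ∀ q, DD (1, 0) h q = DD (0, d 0) (G 1 2) q + DD (0, d 1) (G 2 0) q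
      + DD (0, d 2) (G 0 1) q := by
    intro q
    rw [hGd 1 2, hGd 2 0, hGd 0 1, hh]
    rw [DD_add ((((hD (0, d 1) 2).sub (hD (0, d 2) 1)).mul (hv 0)).add
        (((hD (0, d 2) 0).sub (hD (0, d 0) 2)).mul (hv 1)))
        (((hD (0, d 0) 1).sub (hD (0, d 1) 0)).mul (hv 2)),
      DD_add (((hD (0, d 1) 2).sub (hD (0, d 2) 1)).mul (hv 0))
        (((hD (0, d 2) 0).sub (hD (0, d 0) 2)).mul (hv 1)),
      DD_mul ((hD (0, d 1) 2).sub (hD (0, d 2) 1)) (hv 0),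
      DD_mul ((hD (0, d 2) 0).sub (hD (0, d 0) 2)) (hv 1),
      DD_mul ((hD (0, d 0) 1).sub (hD (0, d 1) 0)) (hv 2),
      DD_sub (hD (0, d 1) 2) (hD (0, d 2) 1), DD_sub (hD (0, d 2) 0) (hD (0, d 0) 2),
      DD_sub (hD (0, d 0) 1) (hD (0, d 1) 0)]
    have hcm : ∀ i j, DD (1, 0) (DD (0, d j) (v i)) q = DD (0, d j) (DD (1, 0) (v i)) q :=
      fun i j => DD_comm (hv i) _ _ q
    simp only [hcm]
    rw [DD_comm (hv 2) (0, d 1) (0, d 0), DD_comm (hv 1) (0, d 2) (0, d 0),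
      DD_comm (hv 0) (0, d 2) (0, d 1)]
    simp only [heul _ q]
    ring
  have hder : ∀ t, HasDerivAt (fun s => ∫ x, h (s, x) ∂(volume : Measure E)) 0 t := by
    intro t
    have h1 := integral_deriv hsm hK hh0 t
    have hi : ∀ j k w, Integrable (fun x => DD w (G j k) (t, x)) (volume : Measure E) :=
      fun j k w => slice_integrable (DD_smooth (hGs j k) w).continuous hK
        (DD_supp hK (hG0 j k) w) t
    have h2 : ∫ x, DD (1, 0) h (t, x) ∂(volume : Measure E) = 0 := by
      simp only [key]
      have hs : Integrable (fun x => DD (0, d 0) (G 1 2) (t, x) + DD (0, d 1) (G 2 0) (t, x))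
        (volume : Measure E) := (hi _ _ _).add (hi _ _ _)
      rw [integral_add hs (hi _ _ _), integral_add (hi _ _ _) (hi _ _ _)]
      simp [integral_DD_space (hGs _ _) hK (hG0 _ _)]
    rwa [h2] at h1
  exact is_const_of_deriv_eq_zero (fun t => (hder t).differentiableAt)
    (fun t => (hder t).deriv) t₁ t₂

lemma fderiv_comp_apply {V : ℝ × E → E} (hV : ContDiff ℝ (⊤ : ℕ∞) V) (t : ℝ) (x w : E)
    (i : Fin 3) : fderiv ℝ (fun y => V (t, y)) x w i = DD (0, w) (fun q => V q i) (t, x) := by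
  have hc : ContDiff ℝ (⊤ : ℕ∞) (fun q => V q i) := contDiff_euclidean.1 hV i
  rw [← slice_fderiv hc]
  have hd : DifferentiableAt ℝ (fun y => V (t, y)) x :=
    ((hV.differentiable (by simp)).comp (by fun_prop : Differentiable ℝ fun y : E => (t, y))) x
  have := ((EuclideanSpace.proj (𝕜 := ℝ) i).hasFDerivAt.comp x hd.hasFDerivAt).fderiv
  have h' : fderiv ℝ (fun y => V (t, y) i) x = _ := this
  rw [h']
  simp

/-- The kinetic moment (helicity) `∫ ⟪rot V, V⟫` is a first integral of the
Euler equations. -/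
theorem helicity_first_integral (V : ℝ × E → E) (p : ℝ × E → ℝ)
    (hV : ContDiff ℝ (⊤ : ℕ∞) V) (hp : ContDiff ℝ (⊤ : ℕ∞) p)
    (K : Set E) (hK : IsCompact K) (hsupp : ∀ t, ∀ x ∉ K, V (t, x) = 0)
    (hdiv : ∀ t x, div (fun y => V (t, y)) x = 0)
    (heuler : ∀ t x, deriv (fun s => V (s, x)) t
      = -fderiv ℝ (fun y => V (t, y)) x (V (t, x)) - gradient (fun y => p (t, y)) x) :
    ∀ t₁ t₂ : ℝ, ∫ x, ⟪curl (fun y => V (t₁, y)) x, V (t₁, x)⟫ ∂(volume : Measure E)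
      = ∫ x, ⟪curl (fun y => V (t₂, y)) x, V (t₂, x)⟫ ∂(volume : Measure E) := by
  intro t₁ t₂
  have hc : ∀ i, ContDiff ℝ (⊤ : ℕ∞) (fun q => V q i) := contDiff_euclidean.1 hV
  have main := helicity_scalar (fun i q => V q i) p hc hp e K hK
    (fun i q hq => by simp [hsupp q.1 q.2 hq]) ?_ t₁ t₂ _ rfl
  · have hint : ∀ t x, ⟪curl (fun y => V (t, y)) x, V (t, x)⟫ =
        (DD (0, e 1) (fun q => V q 2) (t, x) - DD (0, e 2) (fun q => V q 1) (t, x)) * V (t, x) 0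
        + (DD (0, e 2) (fun q => V q 0) (t, x) - DD (0, e 0) (fun q => V q 2) (t, x)) * V (t, x) 1
        + (DD (0, e 0) (fun q => V q 1) (t, x) - DD (0, e 1) (fun q => V q 0) (t, x))
          * V (t, x) 2 := fun t x => by
      rw [PiLp.inner_apply, Fin.sum_univ_three]
      simp only [curl, fderiv_comp_apply hV]
      simp [mul_comm]
    simp only [hint]
    exact main
  · rintro i ⟨t, x⟩
    have hE := congrArg (fun z : E => z i) (heuler t x)
    have hd : DifferentiableAt ℝ (fun s => V (s, x)) t :=
      ((hV.differentiable (by simp)).comp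
        (by fun_prop : Differentiable ℝ fun s : ℝ => (s, x))) t
    have h1 : deriv (fun s => V (s, x)) t i = DD (1, 0) (fun q => V q i) (t, x) := by
      have a := (EuclideanSpace.proj (𝕜 := ℝ) i).hasFDerivAt.comp_hasDerivAt t hd.hasDerivAt
      exact HasDerivAt.unique a (slice_time (hc i) t x)
    have h2 : gradient (fun y => p (t, y)) x i = DD (0, e i) p (t, x) := by
      rw [← slice_fderiv hp]
      have : ⟪gradient (fun y => p (t, y)) x, e i⟫ = fderiv ℝ (fun y => p (t, y)) x (e i) := by
        simp [gradient]
      rw [← this, e, EuclideanSpace.inner_single_right]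
      simp
    have h3 : V (t, x) = V (t, x) 0 • e 0 + V (t, x) 1 • e 1 + V (t, x) 2 • e 2 := by
      ext j
      fin_cases j <;> simp [e]
    have h4 : fderiv ℝ (fun y => V (t, y)) x (V (t, x)) i =
        V (t, x) 0 * DD (0, e 0) (fun q => V q i) (t, x)
        + V (t, x) 1 * DD (0, e 1) (fun q => V q i) (t, x)
        + V (t, x) 2 * DD (0, e 2) (fun q => V q i) (t, x) := by
      conv_lhs => rw [h3]
      simp only [map_add, map_smul, PiLp.add_apply, PiLp.smul_apply, smul_eq_mul,
        fderiv_comp_apply hV]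
    simp only [PiLp.sub_apply, PiLp.neg_apply] at hE
    rw [h1, h2, h4] at hE
    exact hE
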